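/- Every L({∃}) concept C of size at most k' = n + k + 2 that fits P = {(I,a)}, N = {(J,b)} is of the form ∃r.∃t_1.∃t_2.….∃t_ℓ.A where each t_j ∈ {r,s}, the word t_1⋯t_ℓ can be written as w_1 w_2 ⋯ w_n with each block w_i ∈ {r, ss} and at most k of the blocks equal to ss; moreover, the set H = {i ∈ {1,…,n} | w_i = ss} is a hitting set of {S_1,…,S_m} of size at most k. -/

import Mathlib

open scoped ENNReal

namespace ALCPaper

/-- ALC concepts; concept names and role names are natural numbers. -/
inductive ALC : Type
  | bot
  | top
  | atom (A : ℕ)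
  | neg (c : ALC)
  | inter (c d : ALC)
  | union (c d : ALC)
  | all (r : ℕ) (c : ALC)
  | ex (r : ℕ) (c : ALC)
  deriving DecidableEq

/-- An interpretation: a domain of natural numbers, extensions of concept names,
and extensions of role names. -/
structure Interp where
  dom : Set ℕ
  cI : ℕ → Set ℕ
  rI : ℕ → Set (ℕ × ℕ)

/-- Well-formedness of an interpretation: the domain is nonempty, concept name
extensions are subsets of the domain and role name extensions are binary relations
on the domain. -/
def Interp.WF (I : Interp) : Prop :=
  I.dom.Nonempty ∧ (∀ A, I.cI A ⊆ I.dom) ∧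
    ∀ r, ∀ p ∈ I.rI r, p.1 ∈ I.dom ∧ p.2 ∈ I.dom

/-- The extension `C^I` of a concept `C` in an interpretation `I`. -/
def ALC.sem : ALC → Interp → Set ℕ
  | .bot, _ => ∅
  | .top, I => I.dom
  | .atom A, I => I.cI A
  | .neg c, I => I.dom \ c.sem I
  | .inter c d, I => c.sem I ∩ d.sem I
  | .union c d, I => c.sem I ∪ d.sem I
  | .all r c, I => {d | d ∈ I.dom ∧ ∀ e, (d, e) ∈ I.rI r → e ∈ c.sem I}
  | .ex r c, I => {d | ∃ e, (d, e) ∈ I.rI r ∧ e ∈ c.sem I}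

/-- The size of a concept: the number of nodes of its syntax tree. -/
def ALC.size : ALC → ℕ
  | .bot => 1
  | .top => 1
  | .atom _ => 1
  | .neg c => c.size + 1
  | .inter c d => c.size + d.size + 1
  | .union c d => c.size + d.size + 1
  | .all _ c => c.size + 1
  | .ex _ c => c.size + 1

/-- The quantifier depth of a concept: the nesting depth of ∃/∀. -/
def ALC.qdepth : ALC → ℕ
  | .bot => 0
  | .top => 0
  | .atom _ => 0
  | .neg c => c.qdepth
  | .inter c d => max c.qdepth d.qdepth
  | .union c d => max c.qdepth d.qdepth
  | .all _ c => c.qdepth + 1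
  | .ex _ c => c.qdepth + 1

/-- The concept names occurring in a concept. -/
def ALC.conceptNames : ALC → Finset ℕ
  | .bot => ∅
  | .top => ∅
  | .atom A => {A}
  | .neg c => c.conceptNames
  | .inter c d => c.conceptNames ∪ d.conceptNames
  | .union c d => c.conceptNames ∪ d.conceptNames
  | .all _ c => c.conceptNames
  | .ex _ c => c.conceptNames

/-- The role names occurring in a concept. -/
def ALC.roleNames : ALC → Finset ℕ
  | .bot => ∅
  | .top => ∅
  | .atom _ => ∅
  | .neg c => c.roleNames
  | .inter c d => c.roleNames ∪ d.roleNames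
  | .union c d => c.roleNames ∪ d.roleNames
  | .all r c => insert r c.roleNames
  | .ex r c => insert r c.roleNames

/-- The five constructors ¬, ⊓, ⊔, ∀, ∃. -/
inductive Op : Type
  | neg | inter | union | all | ex
  deriving DecidableEq

/-- Membership in the fragment L(O): the concept is built from ⊤, ⊥ and concept
names using only constructors from O. -/
def ALC.InLang (O : Set Op) : ALC → Prop
  | .bot => True
  | .top => True
  | .atom _ => True
  | .neg c => Op.neg ∈ O ∧ c.InLang O
  | .inter c d => Op.inter ∈ O ∧ c.InLang O ∧ d.InLang O
  | .union c d => Op.union ∈ O ∧ c.InLang O ∧ d.InLang O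
  | .all _ c => Op.all ∈ O ∧ c.InLang O
  | .ex _ c => Op.ex ∈ O ∧ c.InLang O

/-- The dual of a constructor. -/
def Op.dual : Op → Op
  | .neg => .neg
  | .inter => .union
  | .union => .inter
  | .all => .ex
  | .ex => .all

/-- The dual concept C̄. -/
def ALC.dual : ALC → ALC
  | .bot => .top
  | .top => .bot
  | .atom A => .atom A
  | .neg c => .neg c.dual
  | .inter c d => .union c.dual d.dual
  | .union c d => .inter c.dual d.dual
  | .all r c => .ex r c.dual
  | .ex r c => .all r c.dual

open Classical in
/-- The interpretation Ī_Σ obtained by complementing the extensions of the concept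
names in Σ (here `S` is the set of concept names of the signature Σ). -/
noncomputable def Interp.dualWrt (I : Interp) (S : Set ℕ) : Interp where
  dom := I.dom
  cI := fun A => if A ∈ S then I.dom \ I.cI A else I.cI A
  rI := I.rI

/-- A pointed interpretation. -/
abbrev Ex : Type := Interp × ℕ

/-- A finite interpretation: finite domain and only finitely many concept and role
names with nonempty extension. -/
def Interp.FiniteI (I : Interp) : Prop :=
  I.dom.Finite ∧ {A | (I.cI A).Nonempty}.Finite ∧ {r | (I.rI r).Nonempty}.Finite

/-- An example: a finite (well-formed) interpretation with a distinguished domain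
element. -/
def IsExample (e : Ex) : Prop := e.1.WF ∧ e.1.FiniteI ∧ e.2 ∈ e.1.dom

/-- The dual example (Ī_Σ, a). -/
noncomputable def dualEx (S : Set ℕ) (e : Ex) : Ex := (e.1.dualWrt S, e.2)

/-- `C` fits the positive examples `P` and the negative examples `N`. -/
def Fits (C : ALC) (P N : Set Ex) : Prop :=
  (∀ e ∈ P, e.2 ∈ C.sem e.1) ∧ ∀ e ∈ N, e.2 ∉ C.sem e.1

/-- Subsumption C ⊑ D: `C^I ⊆ D^I` for every interpretation `I`. -/
def Subsume (C D : ALC) : Prop := ∀ I : Interp, I.WF → C.sem I ⊆ D.sem I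

/-- Equivalence of concepts. -/
def CEquiv (C D : ALC) : Prop := Subsume C D ∧ Subsume D C

/-- The concept names occurring in (the facts of) a set of examples. -/
def exCNames (E : Set Ex) : Set ℕ := {A | ∃ e ∈ E, (e.1.cI A).Nonempty}

/-- The role names occurring in (the facts of) a set of examples. -/
def exRNames (E : Set Ex) : Set ℕ := {r | ∃ e ∈ E, (e.1.rI r).Nonempty}

/-! Encoding of the domain elements used in the hitting-set reduction.
Tags < 7 together with `Nat.pair` give an injective encoding into ℕ. -/

def el (tag j i : ℕ) : ℕ := tag + 7 * Nat.pair j i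

/-- the root `b` of `J` -/
def eB : ℕ := el 0 0 0
/-- the element `b_{j,i}` -/
def eBB (j i : ℕ) : ℕ := el 1 j i
/-- the element `b'_{j,i}` -/
def eBB' (j i : ℕ) : ℕ := el 2 j i
/-- the sink `c` -/
def eC : ℕ := el 3 0 0
/-- the root `a` of `I` -/
def eA : ℕ := el 4 0 0
/-- the element `a_i` -/
def eAA (i : ℕ) : ℕ := el 5 0 i
/-- the element `a'_i` -/
def eAA' (i : ℕ) : ℕ := el 6 0 i

/-- The r-edges of `J` not involving the root `b`. -/
def JrCore (m n : ℕ) (S : ℕ → Set ℕ) : Set (ℕ × ℕ) :=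
  {p | ∃ j i, 1 ≤ j ∧ j ≤ m ∧ 1 ≤ i ∧ i ≤ n ∧ p = (eBB j (i - 1), eBB j i)} ∪
  {p | ∃ j i, 1 ≤ j ∧ j ≤ m ∧ 1 ≤ i ∧ i ≤ n ∧ i ∉ S j ∧ p = (eBB' j i, eC)} ∪
  {p | ∃ j, 1 ≤ j ∧ j ≤ m ∧ p = (eBB j n, eC)} ∪ {(eC, eC)}

/-- The r-edges of `J`. -/
def JrPairs (m n : ℕ) (S : ℕ → Set ℕ) : Set (ℕ × ℕ) :=
  {p | ∃ j, 1 ≤ j ∧ j ≤ m ∧ p = (eB, eBB j 0)} ∪ JrCore m n S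

/-- The s-edges of `J` (none of them involves the root `b`). -/
def JsPairs (m n : ℕ) (S : ℕ → Set ℕ) : Set (ℕ × ℕ) :=
  {p | ∃ j i, 1 ≤ j ∧ j ≤ m ∧ 1 ≤ i ∧ i ≤ n ∧ i ∉ S j ∧
      (p = (eBB j (i - 1), eBB' j i) ∨ p = (eBB' j i, eBB j i))} ∪
  {p | ∃ j i, 1 ≤ j ∧ j ≤ m ∧ 1 ≤ i ∧ i ≤ n ∧ i ∈ S j ∧ p = (eBB j (i - 1), eC)} ∪
  {p | ∃ j, 1 ≤ j ∧ j ≤ m ∧ p = (eBB j n, eC)} ∪ {(eC, eC)}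

/-- The domain of `J`. -/
def Jdom (m n : ℕ) (S : ℕ → Set ℕ) : Set ℕ :=
  {eB} ∪ {x | ∃ j i, 1 ≤ j ∧ j ≤ m ∧ i ≤ n ∧ x = eBB j i} ∪
  {x | ∃ j i, 1 ≤ j ∧ j ≤ m ∧ 1 ≤ i ∧ i ≤ n ∧ i ∉ S j ∧ x = eBB' j i} ∪ {eC}

/-- The interpretation `J` of the reduction; concept name `A` is 0, role names
`r`, `s` are 0 and 1. -/
def Jinterp (m n : ℕ) (S : ℕ → Set ℕ) : Interp where
  dom := Jdom m n S
  cI := fun A => if A = 0 then {x | ∃ j, 1 ≤ j ∧ j ≤ m ∧ x = eBB j n} else ∅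
  rI := fun ρ => if ρ = 0 then JrPairs m n S else if ρ = 1 then JsPairs m n S else ∅

/-- The domain of `I`: `J` without `b`, extended by `a`, `a_0, …, a_n` and
`a'_1, …, a'_n`. -/
def Idom (m n : ℕ) (S : ℕ → Set ℕ) : Set ℕ :=
  (Jdom m n S \ {eB}) ∪ {eA} ∪ {x | ∃ i, i ≤ n ∧ x = eAA i} ∪
  {x | ∃ i, 1 ≤ i ∧ i ≤ n ∧ x = eAA' i}

/-- The r-edges of `I`. -/
def IrPairs (m n : ℕ) (S : ℕ → Set ℕ) : Set (ℕ × ℕ) :=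
  JrCore m n S ∪ {(eA, eAA 0)} ∪ {p | ∃ j, 1 ≤ j ∧ j ≤ m ∧ p = (eA, eBB j 0)} ∪
  {p | ∃ i, 1 ≤ i ∧ i ≤ n ∧ p = (eAA (i - 1), eAA i)} ∪
  {p | ∃ i, 1 ≤ i ∧ i ≤ n ∧ p = (eAA' i, eC)} ∪ {(eAA n, eC)}

/-- The s-edges of `I`. -/
def IsPairs (m n : ℕ) (S : ℕ → Set ℕ) : Set (ℕ × ℕ) :=
  JsPairs m n S ∪
  {p | ∃ i, 1 ≤ i ∧ i ≤ n ∧ (p = (eAA (i - 1), eAA' i) ∨ p = (eAA' i, eAA i))} ∪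
  {(eAA n, eC)}

/-- The interpretation `I` of the reduction. -/
def Iinterp (m n : ℕ) (S : ℕ → Set ℕ) : Interp where
  dom := Idom m n S
  cI := fun A =>
    if A = 0 then {x | ∃ j, 1 ≤ j ∧ j ≤ m ∧ x = eBB j n} ∪ {eAA n} else ∅
  rI := fun ρ => if ρ = 0 then IrPairs m n S else if ρ = 1 then IsPairs m n S else ∅

/-- The concepts `C_i` built from a hitting set `H`: `C_0 = A` and
`C_i = ∃s.∃s.C_{i-1}` if `n − i + 1 ∈ H`, `C_i = ∃r.C_{i-1}` otherwise. -/
def hsConcept (H : Finset ℕ) (n : ℕ) : ℕ → ALC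
  | 0 => .atom 0
  | i + 1 => if n - i ∈ H then .ex 1 (.ex 1 (hsConcept H n i)) else .ex 0 (hsConcept H n i)

/-- `chainA [t₁, …, t_ℓ]` is the concept `∃t₁.….∃t_ℓ.A`. -/
def chainA : List ℕ → ALC
  | [] => .atom 0
  | t :: ts => .ex t (chainA ts)

lemma el_inj {t j i t' j' i' : ℕ} (ht : t < 7) (ht' : t' < 7) :
    el t j i = el t' j' i' ↔ t = t' ∧ j = j' ∧ i = i' := by
  constructor
  · intro h
    unfold el at h
    have h1 : t = t' := by omega
    have h2 : Nat.pair j i = Nat.pair j' i' := by omega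
    exact ⟨h1, Nat.pair_eq_pair.1 h2⟩
  · rintro ⟨rfl, rfl, rfl⟩; rfl

def core (m n : ℕ) (S : ℕ → Set ℕ) (x : ℕ) : Prop :=
  (∃ j i, 1 ≤ j ∧ j ≤ m ∧ i ≤ n ∧ x = eBB j i) ∨
  (∃ j i, 1 ≤ j ∧ j ≤ m ∧ 1 ≤ i ∧ i ≤ n ∧ i ∉ S j ∧ x = eBB' j i) ∨ x = eC

lemma edge_AA {m n : ℕ} {S : ℕ → Set ℕ} {t i y : ℕ}
    (h : (eAA i, y) ∈ (Iinterp m n S).rI t) :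
    (t = 0 ∧ i < n ∧ y = eAA (i+1)) ∨ (t = 1 ∧ i < n ∧ y = eAA' (i+1)) ∨
      ((t = 0 ∨ t = 1) ∧ y = eC) := by
  unfold Iinterp at h
  dsimp only at h
  split_ifs at h with h0 h1
  · simp only [IrPairs, JrCore, Set.mem_union, Set.mem_setOf_eq, Set.mem_singleton_iff,
      Prod.mk.injEq, eB, eBB, eBB', eC, eA, eAA, eAA'] at h ⊢
    simp [el_inj] at h
    rcases h with ⟨i', h1, h2, h3, h4⟩ | ⟨h1, h2⟩
    · left; refine ⟨h0, by omega, ?_⟩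
      rw [h4]; congr 1; omega
    · right; right; exact ⟨Or.inl h0, h2⟩
  · simp only [IsPairs, JsPairs, Set.mem_union, Set.mem_setOf_eq, Set.mem_singleton_iff,
      Prod.mk.injEq, eB, eBB, eBB', eC, eA, eAA, eAA'] at h ⊢
    simp [el_inj] at h
    rcases h with ⟨i', h1, h2, h3, h4⟩ | ⟨h1, h2⟩
    · right; left; refine ⟨by assumption, by omega, ?_⟩
      rw [h4]; congr 1; omega
    · right; right; exact ⟨Or.inr (by assumption), h2⟩
  · exact h.elim

lemma edge_AA' {m n : ℕ} {S : ℕ → Set ℕ} {t i y : ℕ}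
    (h : (eAA' i, y) ∈ (Iinterp m n S).rI t) :
    (t = 1 ∧ y = eAA i) ∨ (t = 0 ∧ y = eC) := by
  unfold Iinterp at h
  dsimp only at h
  split_ifs at h with h0 h1
  · simp only [IrPairs, JrCore, Set.mem_union, Set.mem_setOf_eq, Set.mem_singleton_iff,
      Prod.mk.injEq, eB, eBB, eBB', eC, eA, eAA, eAA'] at h ⊢
    simp [el_inj] at h
    exact Or.inr ⟨h0, h.2.2⟩
  · simp only [IsPairs, JsPairs, Set.mem_union, Set.mem_setOf_eq, Set.mem_singleton_iff,
      Prod.mk.injEq, eB, eBB, eBB', eC, eA, eAA, eAA'] at h ⊢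
    simp [el_inj] at h
    exact Or.inl ⟨h1, h.2.2⟩
  · exact h.elim

lemma edge_A {m n : ℕ} {S : ℕ → Set ℕ} {t y : ℕ}
    (h : (eA, y) ∈ (Iinterp m n S).rI t) :
    t = 0 ∧ (y = eAA 0 ∨ ∃ j, 1 ≤ j ∧ j ≤ m ∧ y = eBB j 0) := by
  unfold Iinterp at h
  dsimp only at h
  split_ifs at h with h0 h1
  · simp only [IrPairs, JrCore, Set.mem_union, Set.mem_setOf_eq, Set.mem_singleton_iff,
      Prod.mk.injEq, eB, eBB, eBB', eC, eA, eAA, eAA'] at h ⊢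
    simp [el_inj] at h
    exact ⟨h0, h⟩
  · simp only [IsPairs, JsPairs, Set.mem_union, Set.mem_setOf_eq, Set.mem_singleton_iff,
      Prod.mk.injEq, eB, eBB, eBB', eC, eA, eAA, eAA'] at h ⊢
    simp [el_inj] at h
  · exact h.elim

lemma edge_core {m n : ℕ} {S : ℕ → Set ℕ} {t x y : ℕ} (hx : core m n S x)
    (h : (x, y) ∈ (Iinterp m n S).rI t) :
    (x, y) ∈ (Jinterp m n S).rI t ∧ core m n S y := by
  have n1 : x ≠ eA := by
    rcases hx with ⟨j, i, -, -, -, rfl⟩ | ⟨j, i, -, -, -, -, -, rfl⟩ | rfl <;>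
      simp [eBB, eBB', eC, eA, el_inj]
  have n2 : ∀ i, x ≠ eAA i := by
    intro i'
    rcases hx with ⟨j, i, -, -, -, rfl⟩ | ⟨j, i, -, -, -, -, -, rfl⟩ | rfl <;>
      simp [eBB, eBB', eC, eAA, el_inj]
  have n3 : ∀ i, x ≠ eAA' i := by
    intro i'
    rcases hx with ⟨j, i, -, -, -, rfl⟩ | ⟨j, i, -, -, -, -, -, rfl⟩ | rfl <;>
      simp [eBB, eBB', eC, eAA', el_inj]
  unfold Iinterp at h
  unfold Jinterp
  dsimp only at h ⊢
  split_ifs at h ⊢ with h0 h1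
  · simp only [IrPairs, Set.mem_union, Set.mem_setOf_eq, Set.mem_singleton_iff,
      Prod.mk.injEq, n1, n2, n3, false_and, and_false, exists_false, or_false] at h
    refine ⟨Or.inr h, ?_⟩
    simp only [JrCore, Set.mem_union, Set.mem_setOf_eq, Set.mem_singleton_iff,
      Prod.mk.injEq] at h
    rcases h with ((⟨j, i, a, b, c, d, e, f⟩ | ⟨j, i, a, b, c, d, e, e', f⟩) | ⟨j, a, b, c, f⟩) | ⟨e, f⟩
    · exact Or.inl ⟨j, i, a, b, d, f⟩
    · exact Or.inr (Or.inr f)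
    · exact Or.inr (Or.inr f)
    · exact Or.inr (Or.inr f)
  · simp only [IsPairs, Set.mem_union, Set.mem_setOf_eq, Set.mem_singleton_iff,
      Prod.mk.injEq, n1, n2, n3, false_and, and_false, exists_false, or_false] at h
    refine ⟨h, ?_⟩
    simp only [JsPairs, Set.mem_union, Set.mem_setOf_eq, Set.mem_singleton_iff,
      Prod.mk.injEq] at h
    rcases h with ((⟨j, i, a, b, c, d, e, f | f⟩ | ⟨j, i, a, b, c, d, e, e', f⟩) | ⟨j, a, b, c, f⟩) | ⟨e, f⟩
    · exact Or.inr (Or.inl ⟨j, i, a, b, c, d, e, f.2⟩)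
    · exact Or.inl ⟨j, i, a, b, d, f.2⟩
    · exact Or.inr (Or.inr f)
    · exact Or.inr (Or.inr f)
    · exact Or.inr (Or.inr f)
  · exact h.elim

lemma J0 {m n : ℕ} {S : ℕ → Set ℕ} : (Jinterp m n S).rI 0 = JrPairs m n S := by simp [Jinterp]
lemma J1 {m n : ℕ} {S : ℕ → Set ℕ} : (Jinterp m n S).rI 1 = JsPairs m n S := by simp [Jinterp]

lemma core_succ {m n : ℕ} {S : ℕ → Set ℕ} {t x : ℕ} (ht : t = 0 ∨ t = 1)
    (hx : core m n S x) : ∃ y, core m n S y ∧ (x, y) ∈ (Jinterp m n S).rI t := by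
  rcases hx with ⟨j, i, a, b, c, rfl⟩ | ⟨j, i, a, b, c, d, e, rfl⟩ | rfl
  · rcases Nat.lt_or_ge i n with hi | hi
    · rcases ht with rfl | rfl
      · refine ⟨eBB j (i+1), Or.inl ⟨j, i+1, a, b, hi, rfl⟩, ?_⟩
        rw [J0]
        exact Or.inr (Or.inl (Or.inl (Or.inl ⟨j, i+1, a, b, by omega, hi, rfl⟩)))
      · by_cases hS : i + 1 ∈ S j
        · refine ⟨eC, Or.inr (Or.inr rfl), ?_⟩
          rw [J1]
          exact Or.inl (Or.inl (Or.inr ⟨j, i+1, a, b, by omega, hi, hS, rfl⟩))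
        · refine ⟨eBB' j (i+1), Or.inr (Or.inl ⟨j, i+1, a, b, by omega, hi, hS, rfl⟩), ?_⟩
          rw [J1]
          exact Or.inl (Or.inl (Or.inl ⟨j, i+1, a, b, by omega, hi, hS, Or.inl rfl⟩))
    · obtain rfl : i = n := by omega
      refine ⟨eC, Or.inr (Or.inr rfl), ?_⟩
      rcases ht with rfl | rfl
      · rw [J0]; exact Or.inr (Or.inl (Or.inr ⟨j, a, b, rfl⟩))
      · rw [J1]; exact Or.inl (Or.inr ⟨j, a, b, rfl⟩)
  · rcases ht with rfl | rfl
    · refine ⟨eC, Or.inr (Or.inr rfl), ?_⟩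
      rw [J0]; exact Or.inr (Or.inl (Or.inl (Or.inr ⟨j, i, a, b, c, d, e, rfl⟩)))
    · refine ⟨eBB j i, Or.inl ⟨j, i, a, b, d, rfl⟩, ?_⟩
      rw [J1]; exact Or.inl (Or.inl (Or.inl ⟨j, i, a, b, c, d, e, Or.inr rfl⟩))
  · refine ⟨eC, Or.inr (Or.inr rfl), ?_⟩
    rcases ht with rfl | rfl
    · rw [J0]; exact Or.inr (Or.inr rfl)
    · rw [J1]; exact Or.inr rfl

lemma edge_role {m n : ℕ} {S : ℕ → Set ℕ} {t x y : ℕ}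
    (h : (x, y) ∈ (Iinterp m n S).rI t) : t = 0 ∨ t = 1 := by
  unfold Iinterp at h
  dsimp only at h
  split_ifs at h with h0 h1
  · exact Or.inl h0
  · exact Or.inr h1
  · exact h.elim

def Full (m n : ℕ) (S : ℕ → Set ℕ) (D : ALC) : Prop :=
  ∀ x, core m n S x → x ∈ D.sem (Jinterp m n S)

lemma full_top {m n : ℕ} {S : ℕ → Set ℕ} : Full m n S .top := by
  rintro x (h | h | h)
  · exact Or.inl (Or.inl (Or.inr h))
  · exact Or.inl (Or.inr h)
  · exact Or.inr h

lemma full_ex {m n : ℕ} {S : ℕ → Set ℕ} {D : ALC} {t : ℕ} (ht : t = 0 ∨ t = 1)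
    (h : Full m n S D) : Full m n S (.ex t D) := by
  intro x hx
  obtain ⟨y, hy, e⟩ := core_succ ht hx
  exact ⟨y, e, h y hy⟩

lemma core_IJ {m n : ℕ} {S : ℕ → Set ℕ} (D : ALC) (hD : D.InLang {Op.ex}) :
    ∀ x, core m n S x → x ∈ D.sem (Iinterp m n S) → x ∈ D.sem (Jinterp m n S) := by
  induction D with
  | bot => intro x _ h; exact h
  | top => intro x hx _; exact full_top x hx
  | atom A =>
    intro x hx h
    simp only [ALC.sem, Iinterp, Jinterp] at h ⊢
    split_ifs at h ⊢
    · rcases h with h | h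
      · exact h
      · rw [Set.mem_singleton_iff] at h
        subst h
        rcases hx with ⟨j, i, -, -, -, h⟩ | ⟨j, i, -, -, -, -, -, h⟩ | h <;>
          simp [eBB, eBB', eC, eAA, el_inj] at h
    · exact h
  | ex t D ih =>
    rintro x hx ⟨y, e, hy⟩
    obtain ⟨e', cy⟩ := edge_core hx e
    exact ⟨y, e', ih hD.2 y cy hy⟩
  | neg => simp [ALC.InLang] at hD
  | inter => simp [ALC.InLang] at hD
  | union => simp [ALC.InLang] at hD
  | all => simp [ALC.InLang] at hD

lemma edge_C {m n : ℕ} {S : ℕ → Set ℕ} {t y : ℕ}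
    (h : (eC, y) ∈ (Iinterp m n S).rI t) : y = eC := by
  unfold Iinterp at h
  dsimp only at h
  split_ifs at h with h0 h1
  · simp only [IrPairs, JrCore, Set.mem_union, Set.mem_setOf_eq, Set.mem_singleton_iff,
      Prod.mk.injEq, eB, eBB, eBB', eC, eA, eAA, eAA'] at h ⊢
    simpa [el_inj] using h
  · simp only [IsPairs, JsPairs, Set.mem_union, Set.mem_setOf_eq, Set.mem_singleton_iff,
      Prod.mk.injEq, eB, eBB, eBB', eC, eA, eAA, eAA'] at h ⊢
    simpa [el_inj] using h
  · exact h.elim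

lemma full_of_C {m n : ℕ} {S : ℕ → Set ℕ} (D : ALC) (hD : D.InLang {Op.ex})
    (h : eC ∈ D.sem (Iinterp m n S)) : Full m n S D := by
  induction D with
  | bot => exact h.elim
  | top => exact full_top
  | atom A =>
    simp only [ALC.sem, Iinterp] at h
    split_ifs at h
    · simp [eBB, eC, eAA, el_inj] at h
    · exact h.elim
  | ex t D ih =>
    obtain ⟨y, e, hy⟩ := h
    obtain rfl := edge_C e
    exact full_ex (edge_role e) (ih hD.2 hy)
  | neg => simp [ALC.InLang] at hD
  | inter => simp [ALC.InLang] at hD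
  | union => simp [ALC.InLang] at hD
  | all => simp [ALC.InLang] at hD

lemma main_I {m n : ℕ} {S : ℕ → Set ℕ} (D : ALC) (hD : D.InLang {Op.ex}) :
    ∀ i, i ≤ n →
    (eAA i ∈ D.sem (Iinterp m n S) → Full m n S D ∨
      ∃ w : List (List ℕ), (∀ blk ∈ w, blk = [0] ∨ blk = [1, 1]) ∧ w.length = n - i ∧
        D = chainA w.flatten) ∧
    (eAA' i ∈ D.sem (Iinterp m n S) → Full m n S D ∨
      ∃ w : List (List ℕ), (∀ blk ∈ w, blk = [0] ∨ blk = [1, 1]) ∧ w.length = n - i ∧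
        D = .ex 1 (chainA w.flatten)) := by
  induction D with
  | bot => exact fun i _ => ⟨fun h => h.elim, fun h => h.elim⟩
  | top => exact fun i _ => ⟨fun h => Or.inl full_top, fun h => Or.inl full_top⟩
  | atom A =>
    intro i hi
    simp only [ALC.sem, Iinterp]
    split_ifs with hA
    · constructor
      · intro h
        simp [eBB, eAA, el_inj] at h
        exact Or.inr ⟨[], by simp, by simp [h], by simp [chainA, hA]⟩
      · intro h
        simp [eBB, eAA, eAA', el_inj] at h
    · exact ⟨fun h => h.elim, fun h => h.elim⟩
  | ex t D ih =>
    intro i hi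
    constructor
    · rintro ⟨y, e, hy⟩
      have hr := edge_role e
      rcases edge_AA e with ⟨rfl, hn, rfl⟩ | ⟨rfl, hn, rfl⟩ | ⟨_, rfl⟩
      · rcases (ih hD.2 (i+1) hn).1 hy with h | ⟨w, h1, h2, rfl⟩
        · exact Or.inl (full_ex hr h)
        · exact Or.inr ⟨[0] :: w, by simpa using h1, by simp; omega, by simp [chainA]⟩
      · rcases (ih hD.2 (i+1) hn).2 hy with h | ⟨w, h1, h2, rfl⟩
        · exact Or.inl (full_ex hr h)
        · exact Or.inr ⟨[1, 1] :: w, by simpa using h1, by simp; omega, by simp [chainA]⟩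
      · exact Or.inl (full_ex hr (full_of_C _ hD.2 hy))
    · rintro ⟨y, e, hy⟩
      have hr := edge_role e
      rcases edge_AA' e with ⟨rfl, rfl⟩ | ⟨rfl, rfl⟩
      · rcases (ih hD.2 i hi).1 hy with h | ⟨w, h1, h2, rfl⟩
        · exact Or.inl (full_ex hr h)
        · exact Or.inr ⟨w, h1, h2, rfl⟩
      · exact Or.inl (full_ex hr (full_of_C _ hD.2 hy))
  | neg => simp [ALC.InLang] at hD
  | inter => simp [ALC.InLang] at hD
  | union => simp [ALC.InLang] at hD
  | all => simp [ALC.InLang] at hD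

lemma main_J {m n : ℕ} {S : ℕ → Set ℕ} {j : ℕ} (hj : 1 ≤ j) (hjm : j ≤ m)
    (w : List (List ℕ)) (hw : ∀ blk ∈ w, blk = [0] ∨ blk = [1, 1]) :
    ∀ i, i + w.length = n → (∀ p < w.length, w.getD p [] = [1, 1] → i + p + 1 ∉ S j) →
      eBB j i ∈ (chainA w.flatten).sem (Jinterp m n S) := by
  induction w with
  | nil =>
    intro i hi _
    simp at hi
    subst hi
    simp [chainA, ALC.sem, Jinterp]
    exact ⟨j, hj, hjm, rfl⟩
  | cons blk w ih =>
    intro i hi h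
    simp only [List.length_cons] at hi h
    have hr := ih (fun b hb => hw b (by simp [hb])) (i+1) (by omega) (by
      intro p hp hp'
      have := h (p+1) (by omega) (by simpa using hp')
      rwa [show i + 1 + p + 1 = i + (p + 1) + 1 by omega])
    rcases hw blk (by simp) with rfl | rfl
    · refine ⟨eBB j (i+1), ?_, hr⟩
      rw [J0]
      exact Or.inr (Or.inl (Or.inl (Or.inl ⟨j, i+1, hj, hjm, by omega, by omega, rfl⟩)))
    · have hS : i + 1 ∉ S j := h 0 (by omega) (by simp)
      refine ⟨eBB' j (i+1), ?_, eBB j (i+1), ?_, hr⟩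
      · rw [J1]
        exact Or.inl (Or.inl (Or.inl ⟨j, i+1, hj, hjm, by omega, by omega, hS, Or.inl rfl⟩))
      · rw [J1]
        exact Or.inl (Or.inl (Or.inl ⟨j, i+1, hj, hjm, by omega, by omega, hS, Or.inr rfl⟩))

lemma size_chain (l : List ℕ) : (chainA l).size = l.length + 1 := by
  induction l with
  | nil => rfl
  | cons t l ih => simp [chainA, ALC.size, ih]

lemma card_blocks (w : List (List ℕ)) (hw : ∀ blk ∈ w, blk = [0] ∨ blk = [1, 1]) :
    w.flatten.length =
      w.length + ((Finset.range w.length).filter fun i => w.getD i [] = [1, 1]).card := by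
  induction w with
  | nil => simp
  | cons b w ih =>
    have h := ih (fun b hb => hw b (by simp [hb]))
    have : ((Finset.range (b :: w).length).filter fun i => (b :: w).getD i [] = [1, 1]).card
        = (if b = [1, 1] then 1 else 0) +
          ((Finset.range w.length).filter fun i => w.getD i [] = [1, 1]).card := by
      rw [Finset.card_filter, Finset.card_filter, List.length_cons, Finset.sum_range_succ']
      simp [add_comm]
    rw [this]
    rcases hw b (by simp) with rfl | rfl
    · simp at h ⊢; omega
    · simp at h ⊢; omega

/-- Every L({∃}) concept C of size at most k' = n + k + 2 that fits
P = {(I,a)}, N = {(J,b)} is of the form ∃r.∃t₁.….∃t_ℓ.A where the word t₁⋯t_ℓ can be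
written as blocks w₁⋯w_n with each block r or ss and at most k blocks equal to ss;
moreover H = {i | w_i = ss} is a hitting set of size at most k. -/
theorem statement8 (m n k : ℕ) (S : ℕ → Set ℕ) (hm : 1 ≤ m)
    (hS : ∀ j, 1 ≤ j → j ≤ m → S j ⊆ Set.Icc 1 n)
    (hcov : ⋃ j ∈ Set.Icc 1 m, S j = Set.Icc 1 n)
    (C : ALC) (hC : C.InLang {Op.ex}) (hsize : C.size ≤ n + k + 2)
    (hfit : Fits C {(Iinterp m n S, eA)} {(Jinterp m n S, eB)}) :
    ∃ w : List (List ℕ),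
      (∀ blk ∈ w, blk = [0] ∨ blk = [1, 1]) ∧
      w.length = n ∧
      C = ALC.ex 0 (chainA w.flatten) ∧
      ((Finset.Icc 1 n).filter fun i => w.getD (i - 1) [] = [1, 1]).card ≤ k ∧
      ∀ j, 1 ≤ j → j ≤ m →
        ∃ x ∈ (Finset.Icc 1 n).filter fun i => w.getD (i - 1) [] = [1, 1], x ∈ S j := by
  have hp : eA ∈ C.sem (Iinterp m n S) := hfit.1 _ rfl
  have hn : eB ∉ C.sem (Jinterp m n S) := hfit.2 _ rfl
  cases C with
  | bot => exact hp.elim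
  | top => exact (hn (Or.inl (Or.inl (Or.inl rfl)))).elim
  | atom A =>
    exfalso
    simp only [ALC.sem, Iinterp] at hp
    split_ifs at hp
    · simp [eBB, eA, eAA, el_inj] at hp
    · exact hp
  | neg => simp [ALC.InLang] at hC
  | inter => simp [ALC.InLang] at hC
  | union => simp [ALC.InLang] at hC
  | all => simp [ALC.InLang] at hC
  | ex t D =>
    obtain ⟨y, e, hy⟩ := hp
    obtain ⟨rfl, hy'⟩ := edge_A e
    have hnj : ∀ j, 1 ≤ j → j ≤ m → eBB j 0 ∉ D.sem (Jinterp m n S) := by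
      intro j h1 h2 h
      refine hn ⟨eBB j 0, ?_, h⟩
      rw [J0]
      exact Or.inl ⟨j, h1, h2, rfl⟩
    have hcj : ∀ j, 1 ≤ j → j ≤ m → core m n S (eBB j 0) := fun j h1 h2 =>
      Or.inl ⟨j, 0, h1, h2, Nat.zero_le _, rfl⟩
    rcases hy' with rfl | ⟨j, h1, h2, rfl⟩
    · rcases (main_I D hC.2 0 (Nat.zero_le _)).1 hy with h | ⟨w, h1, h2, rfl⟩
      · exact (hnj 1 le_rfl hm (h _ (hcj 1 le_rfl hm))).elim
      · rw [Nat.sub_zero] at h2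
        refine ⟨w, h1, h2, rfl, ?_, ?_⟩
        · have hc := card_blocks w h1
          have hs : (chainA w.flatten).size + 1 ≤ n + k + 2 := hsize
          rw [size_chain] at hs
          refine le_trans (Finset.card_le_card_of_injOn (fun i => i - 1)
            (t := (Finset.range w.length).filter fun i => w.getD i [] = [1, 1]) ?_ ?_)
            (by omega)
          · intro i hi
            simp only [Finset.coe_filter, Set.mem_setOf_eq, Finset.mem_Icc,
              Finset.mem_range] at hi ⊢
            exact ⟨by omega, hi.2⟩
          · intro i hi i' hi' hh
            simp only [Finset.coe_filter, Set.mem_setOf_eq, Finset.mem_Icc] at hi hi' hh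
            omega
        · intro j hj hjm
          by_contra hcon
          push Not at hcon
          refine hnj j hj hjm (main_J hj hjm w h1 0 (by omega) ?_)
          intro p hp hp'
          rw [Nat.zero_add]
          refine hcon (p+1) ?_
          rw [Finset.mem_filter, Finset.mem_Icc]
          exact ⟨by omega, by simpa using hp'⟩
    · exact (hnj j h1 h2 (core_IJ D hC.2 _ (hcj j h1 h2) hy)).elim

end ALCPaper
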